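/- Let E₁⁽³⁾(τ) = 1 + 6∑_{n≥1}(∑_{d∣n} χ₃(d))qⁿ, where χ₃(d) is the Legendre symbol (d/3) (equal to 1 if d ≡ 1 mod 3, −1 if d ≡ 2 mod 3, and 0 if 3 ∣ d). Let f : ℍ → ℂ be defined by f(τ) = E₁⁽³⁾(τ)·η(3τ)⁶/η(τ)⁸. Then f is holomorphic on ℍ and satisfies the second-order modular linear differential equation D²f − (1/6)·E₂·Df − (5/48)·E₄·f = 0 on ℍ (this is the MLDE of weight 0 with parameter h = 4, since (h−1)(h+1)/144 = 15/144 = 5/48). (In the paper, f is the normalized character of the simple affine vertex algebra V_{−5/3}(G₂).) -/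

import Mathlib

noncomputable section

open Complex

/-- `q = exp(2πiτ)`. -/
def qc (τ : ℂ) : ℂ := Complex.exp (2 * (Real.pi : ℂ) * Complex.I * τ)

/-- `σ_k(n) = ∑_{d ∣ n} d^k`, as a complex number. -/
def sigmaC (k n : ℕ) : ℂ := ∑ d ∈ n.divisors, (d : ℂ) ^ k

/-- Eisenstein series `E₂(τ) = 1 - 24 ∑_{n≥1} σ₁(n) qⁿ`. -/
def E2 (τ : ℂ) : ℂ := 1 - 24 * ∑' n : ℕ, sigmaC 1 (n + 1) * qc τ ^ (n + 1)

/-- Eisenstein series `E₄(τ) = 1 + 240 ∑_{n≥1} σ₃(n) qⁿ`. -/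
def E4 (τ : ℂ) : ℂ := 1 + 240 * ∑' n : ℕ, sigmaC 3 (n + 1) * qc τ ^ (n + 1)

/-- Eisenstein series `E₆(τ) = 1 - 504 ∑_{n≥1} σ₅(n) qⁿ`. -/
def E6 (τ : ℂ) : ℂ := 1 - 504 * ∑' n : ℕ, sigmaC 5 (n + 1) * qc τ ^ (n + 1)

/-- The normalized derivative of `E₄`: `(DE₄)(τ) = 240 ∑_{n≥1} n σ₃(n) qⁿ`. -/
def DE4 (τ : ℂ) : ℂ := 240 * ∑' n : ℕ, ((n : ℂ) + 1) * sigmaC 3 (n + 1) * qc τ ^ (n + 1)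

/-- Dedekind eta function `η(τ) = exp(2πiτ/24) ∏_{n≥1} (1 - qⁿ)`. -/
def dedekindEta (τ : ℂ) : ℂ :=
  Complex.exp (2 * (Real.pi : ℂ) * Complex.I * τ / 24) * ∏' n : ℕ, (1 - qc τ ^ (n + 1))

/-- Normalized derivative `D = (2πi)⁻¹ d/dτ`. -/
def Dop (f : ℂ → ℂ) : ℂ → ℂ := fun τ => (2 * (Real.pi : ℂ) * Complex.I)⁻¹ * deriv f τ

/-- The upper half-plane, as a subset of `ℂ`. -/
def UHP : Set ℂ := {τ : ℂ | 0 < τ.im}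

/-- The Legendre symbol `(d/3)` as a complex number. -/
def chi3 (d : ℕ) : ℂ := if d % 3 = 1 then 1 else if d % 3 = 2 then -1 else 0

/-- `E₁⁽³⁾(τ) = 1 + 6 ∑_{n≥1} (∑_{d ∣ n} χ₃(d)) qⁿ`. -/
def E1_3 (τ : ℂ) : ℂ :=
  1 + 6 * ∑' n : ℕ, (∑ d ∈ (n + 1).divisors, chi3 d) * qc τ ^ (n + 1)

/-- The normalized character of `V_{-5/3}(G₂)`: `f(τ) = E₁⁽³⁾(τ) η(3τ)⁶ / η(τ)⁸`. -/
def charG2 (τ : ℂ) : ℂ := E1_3 τ * dedekindEta (3 * τ) ^ 6 / dedekindEta τ ^ 8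

namespace G2M
open UpperHalfPlane hiding I
open Derivative ModularGroup
open scoped Manifold MatrixGroups ModularForm Topology

def Phi (X : ℍ → ℂ) : ℍ → ℂ := fun z =>
  (1/2) * X z * serreDerivative 4 (serreDerivative 2 X) z
  - (1/4) * (serreDerivative 2 X z)^2 + X z ^ 2 * serreDerivative 2 X z
  + (1/4) * X z ^ 4 - (5/48) * ModularForm.E₄ z * X z ^ 2

lemma Phi_slash {X : ℍ → ℂ} (hX : MDiff X) (γ : SL(2, ℤ)) :
    Phi X ∣[(8:ℤ)] γ = Phi (X ∣[(2:ℤ)] γ) := by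
  have h1 : serreDerivative 2 X ∣[(4:ℤ)] γ = serreDerivative 2 (X ∣[(2:ℤ)] γ) := by
    simpa only [Int.cast_ofNat, Int.reduceAdd] using serreDerivative_slash_equivariant (k := 2) hX (γ := γ)
  have h2 : serreDerivative 4 (serreDerivative 2 X) ∣[(6:ℤ)] γ
      = serreDerivative 4 (serreDerivative 2 X ∣[(4:ℤ)] γ) := by
    simpa only [Int.cast_ofNat, Int.reduceAdd] using serreDerivative_slash_equivariant (k := 4)
      (serreDerivative_mdifferentiable 2 hX) (γ := γ)
  have h4 : (ModularForm.E₄ : ℍ → ℂ) ∣[(4:ℤ)] γ = ModularForm.E₄ := by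
    have hγ : (γ : GL (Fin 2) ℝ) ∈ 𝒮ℒ := ⟨γ, rfl⟩
    rw [ModularForm.SL_slash]
    exact SlashInvariantForm.slash_action_eqn _ _ hγ
  ext z
  have hd := denom_ne_zero γ z
  have h4z := congrFun h4 z
  rw [ModularForm.SL_slash_apply]
  unfold Phi
  rw [← h1, ← h2, ← h4z]
  simp only [ModularForm.SL_slash_apply]
  generalize denom (γ : GL (Fin 2) ℝ) z = d at *
  simp only [zpow_neg]
  norm_cast
  field_simp

lemma D_bdd {X : ℍ → ℂ} (hX : MDiff X) (hb : IsBoundedAtImInfty X) : IsBoundedAtImInfty (D X) := by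
  rw [isBoundedAtImInfty_iff] at hb ⊢
  obtain ⟨M, A, h⟩ := hb
  refine ⟨‖(2 * Real.pi * I : ℂ)⁻¹‖ * (M / (1/2)), max A 0 + 1, fun z hz => ?_⟩
  rw [mdifferentiable_iff] at hX
  unfold normalizedDerivOfComplex
  rw [norm_mul]
  gcongr
  have key : ∀ w ∈ Metric.closedBall (z:ℂ) (1/2), A ≤ w.im ∧ 0 < w.im := by
    intro w hw
    have h1 : |(w - z).im| ≤ 1/2 := (abs_im_le_norm _).trans (by simpa [dist_eq_norm] using hw)
    rw [abs_le, sub_im] at h1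
    have : (z:ℂ).im = z.im := rfl
    have h2 := le_max_left A 0
    have h3 := le_max_right A 0
    constructor <;> linarith
  apply norm_deriv_le_of_forall_mem_sphere_norm_le (by norm_num)
  · apply DifferentiableOn.diffContOnCl
    apply hX.mono
    intro w hw
    rw [closure_ball _ (by norm_num)] at hw
    exact (key w hw).2
  · intro w hw
    have := key w (Metric.sphere_subset_closedBall hw)
    simp only [Function.comp_apply, ofComplex_apply_of_im_pos this.2]
    exact h _ this.1

lemma bdd_mul {X Y : ℍ → ℂ} (hX : IsBoundedAtImInfty X) (hY : IsBoundedAtImInfty Y) :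
    IsBoundedAtImInfty (fun z => X z * Y z) := Filter.BoundedAtFilter.mul hX hY
lemma bdd_add {X Y : ℍ → ℂ} (hX : IsBoundedAtImInfty X) (hY : IsBoundedAtImInfty Y) :
    IsBoundedAtImInfty (fun z => X z + Y z) := Filter.BoundedAtFilter.add hX hY
lemma bdd_const (c : ℂ) : IsBoundedAtImInfty (fun _ : ℍ => c) := Filter.const_boundedAtFilter _ c
lemma bdd_sub {X Y : ℍ → ℂ} (hX : IsBoundedAtImInfty X) (hY : IsBoundedAtImInfty Y) :
    IsBoundedAtImInfty (fun z => X z - Y z) := by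
  simpa [sub_eq_add_neg] using bdd_add hX (bdd_mul (bdd_const (-1)) hY)
lemma bdd_pow {X : ℍ → ℂ} (hX : IsBoundedAtImInfty X) (n : ℕ) :
    IsBoundedAtImInfty (fun z => X z ^ n) := by
  induction n with
  | zero => simpa using bdd_const 1
  | succ n ih => simpa [pow_succ] using bdd_mul ih hX

lemma serre_bdd {X : ℍ → ℂ} (k : ℂ) (hX : MDiff X) (hb : IsBoundedAtImInfty X) :
    IsBoundedAtImInfty (serreDerivative k X) :=
  bdd_sub (D_bdd hX hb) (bdd_mul (bdd_mul (bdd_const _) EisensteinSeries.isBoundedAtImInfty_E2) hb)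

lemma E4_bdd : IsBoundedAtImInfty (ModularForm.E₄ : ℍ → ℂ) := 
  ModularFormClass.bdd_at_infty ModularForm.E₄

lemma Phi_bdd {X : ℍ → ℂ} (hX : MDiff X) (hb : IsBoundedAtImInfty X) :
    IsBoundedAtImInfty (Phi X) := by
  have h1 := serre_bdd 2 hX hb
  have h2 := serre_bdd 4 (serreDerivative_mdifferentiable 2 hX) h1
  exact bdd_sub (bdd_add (bdd_add (bdd_sub (bdd_mul (bdd_mul (bdd_const _) hb) h2)
    (bdd_mul (bdd_const _) (bdd_pow h1 2))) (bdd_mul (bdd_pow hb 2) h1))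
    (bdd_mul (bdd_const _) (bdd_pow hb 4))) (bdd_mul (bdd_mul (bdd_const _) E4_bdd) (bdd_pow hb 2))

lemma md_mul {X Y : ℍ → ℂ} (hX : MDiff X) (hY : MDiff Y) : MDiff (fun z => X z * Y z) := hX.mul hY
lemma md_add {X Y : ℍ → ℂ} (hX : MDiff X) (hY : MDiff Y) : MDiff (fun z => X z + Y z) := hX.add hY
lemma md_sub {X Y : ℍ → ℂ} (hX : MDiff X) (hY : MDiff Y) : MDiff (fun z => X z - Y z) := hX.sub hY
lemma md_const (c : ℂ) : MDiff (fun _ : ℍ => c) := mdifferentiable_const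
lemma md_pow {X : ℍ → ℂ} (hX : MDiff X) (n : ℕ) : MDiff (fun z => X z ^ n) := hX.pow n

lemma Phi_md {X : ℍ → ℂ} (hX : MDiff X) : MDiff (Phi X) := by
  have h1 := serreDerivative_mdifferentiable 2 hX
  have h2 := serreDerivative_mdifferentiable 4 h1
  exact md_sub (md_add (md_add (md_sub (md_mul (md_mul (md_const _) hX) h2)
    (md_mul (md_const _) (md_pow h1 2))) (md_mul (md_pow hX 2) h1))
    (md_mul (md_const _) (md_pow hX 4)))
    (md_mul (md_mul (md_const _) (ModularFormClass.holo ModularForm.E₄)) (md_pow hX 2))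



/-- `3τ` -/
def tri (z : ℍ) : ℍ := ⟨3 * (z : ℂ), by have := z.im_pos; simpa using this⟩
/-- `τ/3` -/
def third (z : ℍ) : ℍ := ⟨(z : ℂ) / 3, by have := z.im_pos; simpa using this⟩

def A3 (z : ℍ) : ℂ := (3 * EisensteinSeries.E2 (tri z) - EisensteinSeries.E2 z) / 2
def B3 (z : ℍ) : ℂ := (EisensteinSeries.E2 (third z) / 3 - EisensteinSeries.E2 z) / 2

lemma md_comp {X : ℍ → ℂ} (hX : MDiff X) (φ : ℍ → ℍ) (ψ : ℂ → ℂ) (hψ : Differentiable ℂ ψ)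
    (h : ∀ z : ℍ, (φ z : ℂ) = ψ z) : MDiff (fun z => X (φ z)) := by
  rw [mdifferentiable_iff] at hX ⊢
  have : DifferentiableOn ℂ ((X ∘ ofComplex) ∘ ψ) {z | 0 < z.im} := by
    apply hX.comp hψ.differentiableOn
    intro z hz
    have := h ⟨z, hz⟩
    simp only at this
    rw [← this]
    exact (φ ⟨z, hz⟩).im_pos
  apply this.congr
  intro z hz
  have := h ⟨z, hz⟩
  simp only at this
  simp only [Function.comp_apply, ofComplex_apply_of_im_pos hz, ← this, ofComplex_apply]

lemma bdd_comp {X : ℍ → ℂ} (hX : IsBoundedAtImInfty X) (φ : ℍ → ℍ) (c : ℝ) (hc : 0 < c)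
    (h : ∀ z : ℍ, (φ z).im = c * z.im) : IsBoundedAtImInfty (fun z => X (φ z)) := by
  rw [isBoundedAtImInfty_iff] at hX ⊢
  obtain ⟨M, A, hM⟩ := hX
  refine ⟨M, A / c, fun z hz => hM _ ?_⟩
  rw [h]
  rw [div_le_iff₀ hc] at hz
  linarith

lemma A3_md : MDiff A3 := by
  have h1 := md_comp E2_mdifferentiable tri (fun z => 3 * z) (by fun_prop)
    (fun z => rfl)
  have := md_mul (md_const (1/2)) (md_sub (md_mul (md_const 3) h1) E2_mdifferentiable)
  convert this using 2 with z
  simp only [A3]; ring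

lemma A3_bdd : IsBoundedAtImInfty A3 := by
  have h1 := bdd_comp EisensteinSeries.isBoundedAtImInfty_E2 tri 3 (by norm_num)
    (fun z => by rw [← coe_im]; simp [tri])
  have := bdd_mul (bdd_const (1/2)) (bdd_sub (bdd_mul (bdd_const 3) h1)
    EisensteinSeries.isBoundedAtImInfty_E2)
  convert this using 2 with z
  simp only [A3]; ring

lemma B3_bdd : IsBoundedAtImInfty B3 := by
  have h1 := bdd_comp EisensteinSeries.isBoundedAtImInfty_E2 third (1/3) (by norm_num)
    (fun z => by rw [← coe_im]; simp [third]; ring)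
  have := bdd_mul (bdd_const (1/2)) (bdd_sub (bdd_mul (bdd_const (1/3)) h1)
    EisensteinSeries.isBoundedAtImInfty_E2)
  convert this using 2 with z
  simp only [B3]; ring

lemma E2_S (z : ℍ) : EisensteinSeries.E2 (S • z) =
    z ^ 2 * EisensteinSeries.E2 z + 6 * z / (Real.pi * I) := by
  have h := EisensteinSeries.G2_S_transform z
  have hz := ne_zero z
  have hpi : (Real.pi : ℂ) ≠ 0 := by exact_mod_cast Real.pi_ne_zero
  simp only [EisensteinSeries.E2, Pi.smul_apply, smul_eq_mul, riemannZeta_two, h]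
  have hI := I_sq
  field_simp
  ring_nf
  rw [hI]
  ring

lemma slash_T_apply (X : ℍ → ℂ) (k : ℤ) (z : ℍ) : (X ∣[k] T) z = X ((1 : ℝ) +ᵥ z) := by
  have h : denom (T : GL (Fin 2) ℝ) z = 1 := by
    rw [ModularGroup.denom_apply]
    simp [T]
  rw [ModularForm.SL_slash_apply, modular_T_smul, h]
  simp

lemma E2_T (z : ℍ) : EisensteinSeries.E2 ((1 : ℝ) +ᵥ z) = EisensteinSeries.E2 z := by
  rw [← slash_T_apply EisensteinSeries.E2 2, EisensteinSeries.E2_slash_action, EisensteinSeries.D2_T]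
  simp

lemma A3_S : A3 ∣[(2:ℤ)] S = B3 := by
  ext z
  rw [SlashInvariantForm.slash_S_apply]
  have hz := ne_zero z
  have hpi : (Real.pi : ℂ) ≠ 0 := by exact_mod_cast Real.pi_ne_zero
  rw [← modular_S_smul]
  have h1 : tri (S • z) = S • third z := by
    ext
    rw [modular_S_smul, modular_S_smul]
    simp [tri, third]
    field_simp
  rw [A3, B3, h1, E2_S, E2_S]
  have : (third z : ℂ) = z / 3 := rfl
  rw [this, zpow_neg]
  norm_cast
  have hI := I_ne_zero
  field_simp
  ring

lemma A3_T : A3 ∣[(2:ℤ)] T = A3 := by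
  ext z
  rw [slash_T_apply, A3, A3, E2_T]
  have : tri ((1 : ℝ) +ᵥ z) = (1:ℝ) +ᵥ ((1:ℝ) +ᵥ ((1:ℝ) +ᵥ tri z)) := by
    ext
    simp [tri]
    ring
  rw [this, E2_T, E2_T, E2_T]

lemma B3_T3 : ((B3 ∣[(2:ℤ)] T) ∣[(2:ℤ)] T) ∣[(2:ℤ)] T = B3 := by
  ext z
  rw [slash_T_apply, slash_T_apply, slash_T_apply, B3, B3, E2_T, E2_T, E2_T]
  have : third ((1:ℝ) +ᵥ ((1:ℝ) +ᵥ ((1:ℝ) +ᵥ z))) = (1 : ℝ) +ᵥ third z := by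
    ext
    simp [third]
    ring
  rw [this, E2_T]

lemma slash_neg_one (X : ℍ → ℂ) (g h : SL(2, ℤ)) (hgh : g = -h) : X ∣[(2:ℤ)] g = X ∣[(2:ℤ)] h := by
  subst hgh
  ext z
  rw [ModularForm.SL_slash_apply, ModularForm.SL_slash_apply, ModularGroup.SL_neg_smul]
  congr 1
  have : denom (↑(-h) : GL (Fin 2) ℝ) z = - denom (h : GL (Fin 2) ℝ) z := by
    simp [denom]; ring
  rw [this, Even.neg_zpow (by decide)]

def B1 := B3 ∣[(2:ℤ)] T
def B2 := B1 ∣[(2:ℤ)] T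

lemma A3_Tinv : A3 ∣[(2:ℤ)] T⁻¹ = A3 := by
  conv_lhs => rw [← A3_T]
  rw [← SlashAction.slash_mul, mul_inv_cancel, SlashAction.slash_one]

lemma B3_Tinv : B3 ∣[(2:ℤ)] T⁻¹ = B2 := by
  conv_lhs => rw [← B3_T3]
  rw [← SlashAction.slash_mul, mul_inv_cancel, SlashAction.slash_one]
  rfl

lemma B3_S : B3 ∣[(2:ℤ)] S = A3 := by
  rw [← A3_S, ← SlashAction.slash_mul, slash_neg_one A3 (S * S) 1 (by decide), SlashAction.slash_one]

lemma B1_S : B1 ∣[(2:ℤ)] S = B2 := by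
  rw [B1, ← A3_S, ← SlashAction.slash_mul, ← SlashAction.slash_mul,
    show S * (T * S) = T⁻¹ * S * T⁻¹ from by decide, SlashAction.slash_mul, SlashAction.slash_mul,
    A3_Tinv, A3_S, B3_Tinv]

lemma B2_S : B2 ∣[(2:ℤ)] S = B1 := by
  rw [← B1_S, ← SlashAction.slash_mul, slash_neg_one B1 (S * S) 1 (by decide),
    SlashAction.slash_one]

lemma B2_T : B2 ∣[(2:ℤ)] T = B3 := B3_T3

lemma T_bdd {X : ℍ → ℂ} (hX : IsBoundedAtImInfty X) : IsBoundedAtImInfty (X ∣[(2:ℤ)] T) := by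
  have := bdd_comp hX (fun z => (1:ℝ) +ᵥ z) 1 one_pos (by simp)
  convert this using 2 with z
  exact slash_T_apply _ _ _

lemma B1_bdd : IsBoundedAtImInfty B1 := T_bdd B3_bdd
lemma B2_bdd : IsBoundedAtImInfty B2 := T_bdd B1_bdd

lemma md_slash {X : ℍ → ℂ} (hX : MDiff X) (γ : SL(2, ℤ)) : MDiff (X ∣[(2:ℤ)] γ) := hX.slash 2 (γ : GL (Fin 2) ℝ)
lemma B3_md : MDiff B3 := A3_S ▸ md_slash A3_md S
lemma B1_md : MDiff B1 := md_slash B3_md T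
lemma B2_md : MDiff B2 := md_slash B1_md T



/-- The nome on the upper half plane. -/
def qh (z : ℍ) : ℂ := Complex.exp (2 * Real.pi * I * z)

lemma qh_ne (z : ℍ) : qh z ≠ 0 := Complex.exp_ne_zero _

lemma qh_md : MDiff qh := by
  rw [mdifferentiable_iff]
  have : DifferentiableOn ℂ (fun z => Complex.exp (2 * Real.pi * I * z)) {z | 0 < z.im} := by
    fun_prop
  apply this.congr
  intro z hz
  simp [qh, ofComplex_apply_of_im_pos hz]

lemma norm_qh (z : ℍ) : ‖qh z‖ = Real.exp (-2 * Real.pi * z.im) := by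
  rw [qh, Complex.norm_exp]
  simp

lemma qh_bdd : IsBoundedAtImInfty qh := by
  rw [isBoundedAtImInfty_iff]
  refine ⟨1, 0, fun z hz => ?_⟩
  rw [norm_qh, Real.exp_le_one_iff]
  have := z.im_pos
  have := Real.pi_pos
  nlinarith [mul_pos this z.im_pos]

lemma D_qh : D qh = qh := by
  ext z
  unfold normalizedDerivOfComplex
  have h : (qh ∘ ofComplex) =ᶠ[𝓝 (z:ℂ)] (fun w => Complex.exp (2 * Real.pi * I * w)) := by
    filter_upwards [isOpen_upperHalfPlaneSet.mem_nhds z.im_pos] with w hw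
    simp [qh, ofComplex_apply_of_im_pos hw]
  rw [h.deriv_eq]
  have h2 : HasDerivAt (fun w : ℂ => Complex.exp (2 * Real.pi * I * w))
      (Complex.exp (2 * Real.pi * I * z) * (2 * Real.pi * I)) z := by
    have := ((hasDerivAt_id (z:ℂ)).const_mul (2 * Real.pi * I : ℂ)).cexp
    simpa using this
  rw [h2.deriv, qh]
  have hpi : (Real.pi : ℂ) ≠ 0 := by exact_mod_cast Real.pi_ne_zero
  have := I_ne_zero
  field_simp

def Jet (X : ℍ → ℂ) (a b c : ℂ) : Prop :=
  MDiff X ∧ ∃ g : ℍ → ℂ, MDiff g ∧ IsBoundedAtImInfty g ∧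
    ∀ z, X z = a + b * qh z + c * qh z ^ 2 + qh z ^ 3 * g z

lemma Jet.add {X Y : ℍ → ℂ} {a b c a' b' c' : ℂ} (hX : Jet X a b c) (hY : Jet Y a' b' c') :
    Jet (fun z => X z + Y z) (a + a') (b + b') (c + c') := by
  obtain ⟨h1, g, h2, h3, h4⟩ := hX
  obtain ⟨k1, g', k2, k3, k4⟩ := hY
  exact ⟨md_add h1 k1, _, md_add h2 k2, bdd_add h3 k3, fun z => by simp only [h4, k4]; ring⟩

lemma Jet.mul {X Y : ℍ → ℂ} {a b c a' b' c' : ℂ} (hX : Jet X a b c) (hY : Jet Y a' b' c') :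
    Jet (fun z => X z * Y z) (a * a') (a * b' + b * a') (a * c' + b * b' + c * a') := by
  obtain ⟨h1, g, h2, h3, h4⟩ := hX
  obtain ⟨k1, g', k2, k3, k4⟩ := hY
  have l : ∀ u v w : ℂ, MDiff (fun z => u + v * qh z + w * qh z ^ 2) := fun u v w =>
    md_add (md_add (md_const u) (md_mul (md_const v) qh_md)) (md_mul (md_const w) (md_pow qh_md 2))
  have m : ∀ u v w : ℂ, IsBoundedAtImInfty (fun z => u + v * qh z + w * qh z ^ 2) := fun u v w =>
    bdd_add (bdd_add (bdd_const u) (bdd_mul (bdd_const v) qh_bdd))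
      (bdd_mul (bdd_const w) (bdd_pow qh_bdd 2))
  refine ⟨md_mul h1 k1, fun z => ((b * c' + c * b') + (c * c') * qh z + 0 * qh z ^ 2) +
    (g z * Y z + (a + b * qh z + c * qh z ^ 2) * g' z), ?_, ?_, fun z => ?_⟩
  · exact md_add (l _ _ _) (md_add (md_mul h2 k1) (md_mul (l _ _ _) k2))
  · have hYb : IsBoundedAtImInfty Y := by
      have := bdd_add (m a' b' c') (bdd_mul (bdd_pow qh_bdd 3) k3)
      convert this using 2 with z
      exact k4 z
    exact bdd_add (m _ _ _) (bdd_add (bdd_mul h3 hYb) (bdd_mul (m _ _ _) k3))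
  · simp only [h4, k4]; ring

lemma Jet.const (a : ℂ) : Jet (fun _ => a) a 0 0 :=
  ⟨md_const a, fun _ => 0, md_const 0, bdd_const 0, fun z => by ring⟩

lemma Jet.D {X : ℍ → ℂ} {a b c : ℂ} (hX : Jet X a b c) : Jet (D X) 0 b (2 * c) := by
  obtain ⟨h1, g, h2, h3, h4⟩ := hX
  refine ⟨normalizedDerivOfComplex_mdifferentiable h1, fun z => 3 * g z + normalizedDerivOfComplex g z,
    md_add (md_mul (md_const 3) h2) (normalizedDerivOfComplex_mdifferentiable h2),
    bdd_add (bdd_mul (bdd_const 3) h3) (D_bdd h2 h3), fun z => ?_⟩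
  have e : X = ((fun _ => a) + b • qh + c • (qh ^ 2)) + qh ^ 3 * g := by
    ext z; simp [h4]
  have hq2 : MDiff (qh ^ 2) := md_pow qh_md 2
  have hq3 : MDiff (qh ^ 3) := md_pow qh_md 3
  have d1 : MDiff (b • qh) := md_mul (md_const b) qh_md
  have d2 : MDiff (c • qh ^ 2) := md_mul (md_const c) hq2
  have d0 : MDiff (fun _ : ℍ => a) := md_const a
  have d3 : MDiff ((fun _ : ℍ => a) + b • qh) := d0.add d1
  have d4 : MDiff ((fun _ : ℍ => a) + b • qh + c • qh ^ 2) := d3.add d2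
  have d5 : MDiff (qh ^ 3 * g) := hq3.mul h2
  rw [e, normalizedDerivOfComplex_add _ _ d4 d5,
    normalizedDerivOfComplex_add _ _ d3 d2,
    normalizedDerivOfComplex_add _ _ (md_const a) d1,
    normalizedDerivOfComplex_mul _ _ hq3 h2, normalizedDerivOfComplex_smul _ _ qh_md,
    normalizedDerivOfComplex_smul _ _ hq2, normalizedDerivOfComplex_pow _ _ qh_md,
    normalizedDerivOfComplex_pow _ _ qh_md, normalizedDerivOfComplex_const, D_qh]
  simp
  ring

lemma Jet.of_hasSum {X : ℍ → ℂ} (hX : MDiff X) (c : ℕ → ℂ)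
    (h : ∀ z, HasSum (fun m => c m * qh z ^ m) (X z)) : Jet X (c 0) (c 1) (c 2) := by
  refine ⟨hX, fun z => (X z - (c 0 + c 1 * qh z + c 2 * qh z ^ 2)) / qh z ^ 3, ?_, ?_, fun z => ?_⟩
  · have l : MDiff (fun z => X z - (c 0 + c 1 * qh z + c 2 * qh z ^ 2)) :=
      md_sub hX (md_add (md_add (md_const _) (md_mul (md_const _) qh_md))
        (md_mul (md_const _) (md_pow qh_md 2)))
    exact l.div (md_pow qh_md 3) (fun z => pow_ne_zero 3 (qh_ne z))
  · refine isBoundedAtImInfty_of_hasSum_qExpansion (c := fun m => c (m + 3)) (h := 1) one_pos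
      fun z => ?_
    have h3 := (hasSum_nat_add_iff' 3).mpr (h z)
    have h4 := h3.div_const (qh z ^ 3)
    have hX : (X z - (c 0 + c 1 * qh z + c 2 * qh z ^ 2)) / qh z ^ 3 =
        (X z - ∑ i ∈ Finset.range 3, c i * qh z ^ i) / qh z ^ 3 := by
      simp [Finset.sum_range_succ]
    simp only [hX]
    refine h4.congr_fun ?_
    · intro m
      have : Function.Periodic.qParam 1 (z : ℂ) = qh z := by
        simp [Function.Periodic.qParam, qh]
      rw [this, smul_eq_mul, pow_add]
      have := qh_ne z
      field_simp
  · have := qh_ne z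
    field_simp
    ring

lemma Jet.congr {X Y : ℍ → ℂ} {a b c a' b' c' : ℂ} (hX : Jet X a b c) (h : ∀ z, X z = Y z)
    (ha : a = a') (hb : b = b') (hc : c = c') : Jet Y a' b' c' := by
  obtain rfl : X = Y := funext h
  subst ha hb hc
  exact hX

lemma sigma_two (k : ℕ) : ArithmeticFunction.sigma k 2 = 1 + 2 ^ k := by
  simp [ArithmeticFunction.sigma_apply, Nat.Prime.divisors Nat.prime_two]

lemma jet_E2 : Jet EisensteinSeries.E2 1 (-24) (-72) := by
  refine (Jet.of_hasSum E2_mdifferentiable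
    (fun m => if m = 0 then 1 else -24 * ArithmeticFunction.sigma 1 m)
    (fun z => by simpa [qh] using EisensteinSeries.hasSum_qExpansion_E2 (z := z))).congr
    (fun _ => rfl) ?_ ?_ ?_
  · simp
  · simp
  · simp [sigma_two]; norm_num

lemma jet_E2_tri : Jet (fun z => EisensteinSeries.E2 (tri z)) 1 0 0 := by
  have hd : MDiff (fun z => EisensteinSeries.E2 (tri z)) :=
    md_comp E2_mdifferentiable tri (fun z => 3 * z) (by fun_prop) (fun z => rfl)
  obtain ⟨_, g, h2, h3, h4⟩ := jet_E2
  have q3 : ∀ z, qh (tri z) = qh z ^ 3 := fun z => by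
    rw [qh, qh, ← Complex.exp_nat_mul]
    congr 1
    simp [tri]; ring
  have gm : MDiff (fun z => g (tri z)) :=
    md_comp h2 tri (fun z => 3 * z) (by fun_prop) (fun z => rfl)
  have gb := bdd_comp h3 tri 3 (by norm_num) (fun z => by rw [← coe_im]; simp [tri])
  refine ⟨hd, fun z => -24 + -72 * qh z ^ 3 + qh z ^ 6 * g (tri z),
    md_add (md_add (md_const _) (md_mul (md_const _) (md_pow qh_md _))) (md_mul (md_pow qh_md _) gm),
    bdd_add (bdd_add (bdd_const _) (bdd_mul (bdd_const _) (bdd_pow qh_bdd _)))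
      (bdd_mul (bdd_pow qh_bdd _) gb), fun z => ?_⟩
  simp only [h4, q3]
  ring

lemma E4_hasSum (z : ℍ) : HasSum (fun m : ℕ => (if m = 0 then 1 else
    240 * ArithmeticFunction.sigma 3 m : ℂ) * qh z ^ m) (ModularForm.E₄ z) := by
  have hS : Summable fun n : ℕ ↦ (ArithmeticFunction.sigma 3 (n + 1) : ℂ) * qh z ^ (n + 1) :=
    (summable_nat_add_iff 1).mpr (EisensteinSeries.summable_sigma_mul_cexp_pow (k := 4)
      (by norm_num) z)
  rw [← hasSum_nat_add_iff' 1]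
  convert! (hS.mul_left 240).hasSum using 1
  · ext : 1
    simp [mul_assoc]
  · have := EisensteinSeries.q_expansion_bernoulli (k := 4) (by norm_num) ⟨2, rfl⟩ z
    have h2 : ∑' n : ℕ+, (ArithmeticFunction.sigma (4 - 1) n : ℂ) *
        cexp (2 * Real.pi * I * z) ^ (n : ℤ) =
        ∑' n : ℕ, (ArithmeticFunction.sigma 3 (n + 1) : ℂ) * qh z ^ (n + 1) := by
      rw [← tsum_pnat_eq_tsum_succ (f := fun n ↦ (ArithmeticFunction.sigma 3 n : ℂ) * qh z ^ n)]
      simp [qh]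
    rw [show bernoulli 4 = -1 / 30 by decide +kernel, h2] at this
    rw [tsum_mul_left]
    simp only [Finset.range_one, Finset.sum_singleton, if_true, pow_zero, mul_one]
    rw [ModularForm.E₄, this]
    push_cast
    ring
    
lemma jet_E4 : Jet ModularForm.E₄ 1 240 2160 := by
  refine (Jet.of_hasSum (ModularFormClass.holo ModularForm.E₄) _ E4_hasSum).congr
    (fun _ => rfl) ?_ ?_ ?_
  · simp
  · simp
  · simp [sigma_two]; norm_num

lemma jet_A3 : Jet A3 1 12 36 := by
  refine ((Jet.const (3/2)).mul jet_E2_tri |>.add ((Jet.const (-1/2)).mul jet_E2)).congr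
    (fun z => ?_) ?_ ?_ ?_
  · rw [A3]; ring
  all_goals norm_num

lemma Jet.serre (k : ℂ) {X : ℍ → ℂ} {a b c : ℂ} (hX : Jet X a b c) :
    Jet (serreDerivative k X) (-(k / 12) * a) (b - k / 12 * (b - 24 * a))
      (2 * c - k / 12 * (c - 24 * b - 72 * a)) := by
  refine (hX.D.add ((Jet.const (-(k/12))).mul (jet_E2.mul hX))).congr (fun z => ?_) ?_ ?_ ?_
  · rw [serreDerivative_apply]; ring
  all_goals ring

lemma jet_Phi : Jet (Phi A3) 0 0 0 := by
  have h0 := jet_A3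
  have h1 := h0.serre 2
  have h2 := h1.serre 4
  refine (((((Jet.const (1/2)).mul (h0.mul h2)).add ((Jet.const (-1/4)).mul (h1.mul h1))).add
    ((h0.mul h0).mul h1)).add (((Jet.const (1/4)).mul ((h0.mul h0).mul (h0.mul h0))).add
    ((Jet.const (-5/48)).mul (jet_E4.mul (h0.mul h0))))).congr (fun z => ?_) ?_ ?_ ?_
  · rw [Phi]; ring
  all_goals norm_num

/-- The norm. -/
def NN : ℍ → ℂ := (Phi A3 * Phi B3) * (Phi B1 * Phi B2)

lemma NN_slash_aux (γ : SL(2, ℤ)) : NN ∣[(32:ℤ)] γ =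
    (Phi (A3 ∣[(2:ℤ)] γ) * Phi (B3 ∣[(2:ℤ)] γ)) * (Phi (B1 ∣[(2:ℤ)] γ) * Phi (B2 ∣[(2:ℤ)] γ)) := by
  rw [NN, show (32:ℤ) = 16 + 16 by norm_num, ModularForm.mul_slash_SL2,
    show (16:ℤ) = 8 + 8 by norm_num, ModularForm.mul_slash_SL2, ModularForm.mul_slash_SL2,
    Phi_slash A3_md, Phi_slash B3_md, Phi_slash B1_md, Phi_slash B2_md]

lemma NN_slash (γ : SL(2, ℤ)) : NN ∣[(32:ℤ)] γ = NN := by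
  refine SlashInvariantForm.slash_action_generators_SL2Z ?_ ?_ γ
  · rw [NN_slash_aux, A3_S, B3_S, B1_S, B2_S, NN]; ring
  · rw [NN_slash_aux, A3_T, ← B1, ← B2, B2_T, NN]; ring

def DD : ℍ → ℂ := (ModularForm.discriminant * ModularForm.discriminant) * ModularForm.discriminant

lemma disc_slash (γ : SL(2, ℤ)) : ModularForm.discriminant ∣[(12:ℤ)] γ = ModularForm.discriminant := by
  have hγ : (γ : GL (Fin 2) ℝ) ∈ 𝒮ℒ := ⟨γ, rfl⟩
  rw [ModularForm.SL_slash]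
  exact SlashInvariantForm.slash_action_eqn CuspForm.discriminant _ hγ

lemma DD_slash (γ : SL(2, ℤ)) : DD ∣[(36:ℤ)] γ = DD := by
  rw [DD, show (36:ℤ) = 12 + 12 + 12 by norm_num, ModularForm.mul_slash_SL2,
    ModularForm.mul_slash_SL2, disc_slash]

lemma quot_slash (γ : SL(2, ℤ)) : (NN / DD) ∣[(-4:ℤ)] γ = NN / DD := by
  rw [show (-4:ℤ) = 32 - 36 by norm_num, ModularForm.div_slash_SL2, NN_slash, DD_slash]

lemma disc_md : MDiff ModularForm.discriminant := CuspForm.discriminant.holo'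

lemma NN_md : MDiff NN :=
  md_mul (md_mul (Phi_md A3_md) (Phi_md B3_md)) (md_mul (Phi_md B1_md) (Phi_md B2_md))

lemma quot_bdd : IsBoundedAtImInfty (NN / DD) := by
  obtain ⟨_, g, h2, h3, h4⟩ := jet_Phi
  have hq : IsBoundedAtImInfty (fun z => qh z / ModularForm.discriminant z) := by
    have := ModularForm.exp_isBigO_discriminant
    have h : qh =O[atImInfty] ModularForm.discriminant := by
      refine Asymptotics.IsBigO.trans (Asymptotics.IsBigO.of_bound 1 (Filter.Eventually.of_forall fun z => ?_)) this
      rw [norm_qh, Real.norm_of_nonneg (Real.exp_pos _).le, one_mul]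
    exact (Asymptotics.div_isBoundedUnder_of_isBigO h).isBigO_one ℝ
  have := bdd_mul (bdd_pow hq 3) (bdd_mul (bdd_mul h3 (Phi_bdd B3_md B3_bdd))
    (bdd_mul (Phi_bdd B1_md B1_bdd) (Phi_bdd B2_md B2_bdd)))
  convert this using 2 with z
  have hd := ModularForm.discriminant_ne_zero z
  simp only [NN, DD, Pi.div_apply, Pi.mul_apply, h4]
  field_simp
  ring

def quotForm : ModularForm 𝒮ℒ (-4) where
  toFun := NN / DD
  slash_action_eq' := fun _ ⟨γ, hγ⟩ ↦ hγ ▸ quot_slash γ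
  holo' := NN_md.div (md_mul (md_mul disc_md disc_md) disc_md) (fun z => by
    have := ModularForm.discriminant_ne_zero z
    exact mul_ne_zero (mul_ne_zero this this) this)
  bdd_at_cusps' {c} hc := by
    rw [Subgroup.IsArithmetic.isCusp_iff_isCusp_SL2Z] at hc
    rw [OnePoint.isBoundedAt_iff_forall_SL2Z hc]
    intro γ _
    rw [quot_slash γ]
    exact quot_bdd

lemma NN_zero : NN = 0 := by
  have h := ModularFormClass.levelOne_neg_weight_eq_zero (by norm_num) quotForm
  ext z
  have hz : NN z / DD z = 0 := congrFun h z
  have hd := ModularForm.discriminant_ne_zero z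
  have : DD z ≠ 0 := mul_ne_zero (mul_ne_zero hd hd) hd
  simpa [this] using hz

lemma slash_back {X : ℍ → ℂ} (hX : MDiff X) (γ : SL(2, ℤ)) (h : Phi (X ∣[(2:ℤ)] γ) = 0) :
    Phi X = 0 := by
  rw [← Phi_slash hX] at h
  have : (Phi X ∣[(8:ℤ)] γ) ∣[(8:ℤ)] γ⁻¹ = (0 : ℍ → ℂ) ∣[(8:ℤ)] γ⁻¹ := by rw [h]
  rwa [← SlashAction.slash_mul, mul_inv_cancel, SlashAction.slash_one, SlashAction.zero_slash] at this

theorem Phi_A3 : Phi A3 = 0 := by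
  have h := NN_zero
  have m1 : MDiff (Phi A3 * Phi B3) := md_mul (Phi_md A3_md) (Phi_md B3_md)
  have m2 : MDiff (Phi B1 * Phi B2) := md_mul (Phi_md B1_md) (Phi_md B2_md)
  rw [NN, mul_eq_zero_iff m1 m2,
    mul_eq_zero_iff (Phi_md A3_md) (Phi_md B3_md), mul_eq_zero_iff (Phi_md B1_md) (Phi_md B2_md)] at h
  have hb : Phi B3 = 0 → Phi A3 = 0 := fun h => slash_back A3_md S (by rwa [A3_S])
  have hc : Phi B1 = 0 → Phi B3 = 0 := fun h => slash_back B3_md T h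
  have hd : Phi B2 = 0 → Phi B1 = 0 := fun h => slash_back B1_md T h
  tauto


lemma hasSum_anti {f : ℕ × ℕ → ℂ} (hf : Summable f) :
    HasSum (fun k => ∑ p ∈ Finset.HasAntidiagonal.antidiagonal k, f p) (∑' p, f p) := by
  have h := (Finset.HasAntidiagonal.sigmaAntidiagonalEquivProd (A := ℕ)).hasSum_iff.mpr hf.hasSum
  have := h.sigma (g := fun k => ∑ p ∈ Finset.HasAntidiagonal.antidiagonal k, f p) (fun k => by
    rw [← Finset.sum_finset_coe]
    exact hasSum_fintype _)
  exact this

lemma hasSum_triangle {G : ℕ × ℕ → ℂ} (hG : Summable G) (hs : ∀ m n, G (m, n) = G (n, m)) :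
    ∑' p, G p = ∑' n, G (n, n) + 2 * ∑' p : ℕ × ℕ, G (p.1, p.1 + p.2 + 1) := by
  have hd : Summable fun n => G (n, n) :=
    hG.comp_injective (i := fun n => (n, n)) (fun a b h => by simpa using h)
  have hu : Summable fun p : ℕ × ℕ => G (p.1, p.1 + p.2 + 1) :=
    hG.comp_injective (i := fun p : ℕ × ℕ => (p.1, p.1 + p.2 + 1)) (fun a b h => by
      simp only [Prod.mk.injEq] at h
      ext <;> omega)
  have h1 := hasSum_anti hu
  have h2 : HasSum (fun m => ∑ n ∈ Finset.range m, G (m, n))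
      (∑' p : ℕ × ℕ, G (p.1, p.1 + p.2 + 1)) := by
    rw [← hasSum_nat_add_iff' 1]
    simp only [Finset.range_one, Finset.sum_singleton, Finset.range_zero, Finset.sum_empty, sub_zero]
    refine HasSum.congr_fun (h1) fun m => ?_
    rw [Finset.Nat.sum_antidiagonal_eq_sum_range_succ_mk]
    refine Finset.sum_congr rfl fun n hn => ?_
    rw [hs]
    simp only
    congr 2
    have := Finset.mem_range.mp hn
    omega
  have h3 : HasSum (fun m => ∑' k, G (m, m + k + 1)) (∑' p : ℕ × ℕ, G (p.1, p.1 + p.2 + 1)) :=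
    hu.hasSum.prod_fiberwise (fun m => (hu.prod_factor m).hasSum)
  have h4 := (h2.add hd.hasSum).add h3
  have h5 : HasSum (fun m => ∑' n, G (m, n)) (∑' p, G p) :=
    hG.hasSum.prod_fiberwise (fun m => (hG.prod_factor m).hasSum)
  have h6 : ∀ m, ∑' n, G (m, n) =
      ∑ n ∈ Finset.range m, G (m, n) + G (m, m) + ∑' k, G (m, m + k + 1) := by
    intro m
    rw [← (hG.prod_factor m).sum_add_tsum_nat_add (m + 1), Finset.sum_range_succ]
    congr 1
    refine tsum_congr fun k => ?_
    congr 2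
    ring
  rw [funext h6] at h5
  rw [h5.unique h4]
  ring

/-- `c k = 2` if `3 ∣ k`, and `-1` otherwise -/
def cc (k : ℕ) : ℂ := if k % 3 = 0 then 2 else -1

lemma cc_norm (k : ℕ) : ‖cc k‖ ≤ 2 := by
  unfold cc; split_ifs <;> simp

def CC (k : ℕ) : ℂ := ∑ j ∈ Finset.range k, cc (j + 1)

def xx (d : ℕ) : ℂ := if d % 3 = 1 then 1 else if d % 3 = 2 then -1 else 0

lemma xx_mul (m n : ℕ) : 3 * (xx (m + 1) * xx (n + 1)) = cc (Nat.dist m n) - cc (m + n + 2) := by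
  unfold xx cc Nat.dist
  have h1 : m % 3 = 0 ∨ m % 3 = 1 ∨ m % 3 = 2 := by omega
  have h2 : n % 3 = 0 ∨ n % 3 = 1 ∨ n % 3 = 2 := by omega
  rcases h1 with h1 | h1 | h1 <;> rcases h2 with h2 | h2 | h2 <;>
  · split_ifs <;> first | omega | norm_num

lemma CC_eq (k : ℕ) : CC k = if k % 3 = 0 then 0 else if k % 3 = 1 then -1 else -2 := by
  induction k with
  | zero => simp [CC]
  | succ n ih =>
    rw [CC, Finset.sum_range_succ, ← CC, ih]
    unfold cc
    split_ifs <;> first | omega | norm_num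


lemma sum_v {v : ℕ → ℂ} {C r : ℝ} (hr0 : 0 ≤ r) (hr : r < 1) (hv : ∀ n, ‖v n‖ ≤ C * r ^ n)
    : Summable fun n => ‖v n‖ :=
  Summable.of_nonneg_of_le (fun _ => norm_nonneg _) hv
    ((summable_geometric_of_lt_one hr0 hr).mul_left C)

lemma sum_vv {v : ℕ → ℂ} {C r : ℝ} (hr0 : 0 ≤ r) (hr : r < 1) (hv : ∀ n, ‖v n‖ ≤ C * r ^ n)
    (b : ℕ × ℕ → ℂ) (B : ℝ) (hb : ∀ p, ‖b p‖ ≤ B) :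
    Summable fun p : ℕ × ℕ => b p * (v p.1 * v p.2) := by
  have h := sum_v hr0 hr hv
  have h2 := (h.mul_of_nonneg h (fun _ => norm_nonneg _) (fun _ => norm_nonneg _)).mul_left B
  refine Summable.of_norm_bounded h2 fun p => ?_
  rw [norm_mul, norm_mul]
  gcongr
  exact hb p

lemma sum_tail {v : ℕ → ℂ} {C r : ℝ} (hr0 : 0 ≤ r) (hr : r < 1) (hv : ∀ n, ‖v n‖ ≤ C * r ^ n)
    : Summable fun p : ℕ × ℕ => cc (p.1 + 1) * v (p.1 + p.2 + 1) := by
  have h := summable_geometric_of_lt_one hr0 hr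
  have h2 := (h.mul_of_nonneg h (fun _ => by positivity) (fun _ => by positivity)).mul_left
    (2 * C * r)
  refine Summable.of_norm_bounded h2 fun p => ?_
  rw [norm_mul]
  calc _ ≤ 2 * (C * r ^ (p.1 + p.2 + 1)) := by
        gcongr
        · exact cc_norm _
        · exact hv _
    _ = _ := by ring

theorem core_id {v : ℕ → ℂ} {C r : ℝ} (hr0 : 0 ≤ r) (hr : r < 1) (hv : ∀ n, ‖v n‖ ≤ C * r ^ n)
    (hid : ∀ m n, v m * v n = v (m + n + 1) * (1 + v m + v n)) :
    HasSum (fun k => 2 * v k ^ 2 + 2 * cc (k + 1) * v k ^ 2 - 2 * CC k * v k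
      - cc (k + 1) * k * v k) (3 * (∑' n, xx (n + 1) * v n) ^ 2) := by
  have hS1 := sum_vv hr0 hr hv (fun p => cc (Nat.dist p.1 p.2)) 2 (fun p => cc_norm _)
  have hS2 := sum_vv hr0 hr hv (fun p => cc (p.1 + p.2 + 2)) 2 (fun p => cc_norm _)
  have hv1 := (sum_v hr0 hr hv).of_norm
  have hxv : Summable fun n => ‖xx (n + 1) * v n‖ := by
    refine Summable.of_nonneg_of_le (fun _ => norm_nonneg _) (fun n => ?_) (sum_v hr0 hr hv)
    rw [norm_mul]
    have : ‖xx (n + 1)‖ ≤ 1 := by unfold xx; split_ifs <;> simp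
    nlinarith [norm_nonneg (v n)]
  have hsq : 3 * (∑' n, xx (n + 1) * v n) ^ 2 =
      ∑' p : ℕ × ℕ, cc (Nat.dist p.1 p.2) * (v p.1 * v p.2)
      - ∑' p : ℕ × ℕ, cc (p.1 + p.2 + 2) * (v p.1 * v p.2) := by
    rw [sq, tsum_mul_tsum_of_summable_norm hxv hxv, ← tsum_mul_left, ← hS1.tsum_sub hS2]
    refine tsum_congr fun p => ?_
    rw [← sub_mul, ← xx_mul]
    ring
  -- second sum
  have hT2 : HasSum (fun k => cc (k + 1) * v k * (k + 2 * ∑ j ∈ Finset.range k, v j))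
      (∑' p : ℕ × ℕ, cc (p.1 + p.2 + 2) * (v p.1 * v p.2)) := by
    rw [← hasSum_nat_add_iff' 1]
    simp only [Finset.range_one, Finset.sum_singleton, Finset.range_zero, Finset.sum_empty,
      Nat.cast_zero, mul_zero, add_zero, sub_zero]
    refine HasSum.congr_fun (hasSum_anti hS2) fun k => ?_
    have e : ∀ p ∈ Finset.HasAntidiagonal.antidiagonal k, cc (p.1 + p.2 + 2) * (v p.1 * v p.2)
        = cc (k + 2) * v (k + 1) * (1 + v p.1 + v p.2) := by
      intro p hp
      rw [Finset.HasAntidiagonal.mem_antidiagonal] at hp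
      rw [hid, hp]; ring
    rw [Finset.sum_congr rfl e, ← Finset.mul_sum, Finset.sum_add_distrib, Finset.sum_add_distrib]
    rw [Finset.Nat.sum_antidiagonal_eq_sum_range_succ_mk (f := fun p => v p.1),
      Finset.Nat.sum_antidiagonal_eq_sum_range_succ_mk (f := fun p => v p.2)]
    have := Finset.sum_range_reflect v (k + 1)
    simp only [Nat.add_sub_cancel] at this
    have e2 : ∑ x ∈ Finset.range (k + 1), v (k - x) = ∑ x ∈ Finset.range (k + 1), v x := by
      rw [← this]
    simp only [Nat.succ_eq_add_one, e2]
    simp only [Finset.sum_const, Finset.Nat.card_antidiagonal, nsmul_eq_mul, mul_one]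
    push_cast
    ring
  -- first sum
  have hT1 := hasSum_triangle hS1 (fun m n => by
    simp only [Nat.dist_comm m n, mul_comm (v m) (v n)])
  have dd : ∀ n k : ℕ, Nat.dist n (n + k + 1) = k + 1 := by intro n k; unfold Nat.dist; omega
  simp only [Nat.dist_self, dd] at hT1
  have hu : Summable fun p : ℕ × ℕ => cc (p.2 + 1) * (v p.1 * v (p.1 + p.2 + 1)) := by
    have := hS1.comp_injective (i := fun p : ℕ × ℕ => (p.1, p.1 + p.2 + 1)) (fun a b h => by
      simp only [Prod.mk.injEq] at h
      ext <;> omega)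
    simpa only [Function.comp_def, dd] using this
  have hu' := hu.prod_symm
  have hX : HasSum (fun k => ∑' n, cc (k + 1) * (v n * v (n + k + 1)))
      (∑' p : ℕ × ℕ, cc (p.2 + 1) * (v p.1 * v (p.1 + p.2 + 1))) := by
    have h := hu'.hasSum.prod_fiberwise (fun m => (hu'.prod_factor m).hasSum)
    have e := (Equiv.prodComm ℕ ℕ).tsum_eq
      (fun p : ℕ × ℕ => cc (p.2 + 1) * (v p.1 * v (p.1 + p.2 + 1)))
    rw [← e]
    exact h
  have ht := sum_tail hr0 hr hv
  have hTail : HasSum (fun k => ∑' n, cc (k + 1) * v (k + n + 1))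
      (∑' p : ℕ × ℕ, cc (p.1 + 1) * v (p.1 + p.2 + 1)) :=
    ht.hasSum.prod_fiberwise (fun m => (ht.prod_factor m).hasSum)
  have hTail2 : HasSum (fun j => CC j * v j)
      (∑' p : ℕ × ℕ, cc (p.1 + 1) * v (p.1 + p.2 + 1)) := by
    rw [← hasSum_nat_add_iff' 1]
    simp only [Finset.range_one, Finset.sum_singleton, CC, Finset.range_zero, Finset.sum_empty,
      zero_mul, sub_zero]
    refine HasSum.congr_fun (hasSum_anti ht) fun k => ?_
    rw [Finset.Nat.sum_antidiagonal_eq_sum_range_succ_mk, Finset.sum_mul]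
    refine Finset.sum_congr rfl fun j hj => ?_
    simp only
    congr 2
    have := Finset.mem_range.mp hj
    omega
  have hk : ∀ k, ∑' n, cc (k + 1) * (v n * v (n + k + 1)) + ∑' n, cc (k + 1) * v (k + n + 1) =
      cc (k + 1) * v k * (∑ j ∈ Finset.range k, v j + v k) := by
    intro k
    have s1 : Summable fun n => v (n + (k + 1)) := (summable_nat_add_iff (k + 1)).mpr hv1
    have e1 := hv1.sum_add_tsum_nat_add (k + 1)
    have s2 : Summable fun n => cc (k + 1) * (v n * v (n + k + 1)) := hu'.prod_factor k
    have s3 : Summable fun n => cc (k + 1) * v (k + n + 1) := ht.prod_factor k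
    rw [← s2.tsum_add s3]
    rw [← Finset.sum_range_succ, eq_sub_of_add_eq e1, ← hv1.tsum_sub s1, ← tsum_mul_left]
    refine tsum_congr fun n => ?_
    have := hid n k
    have e : k + n + 1 = n + k + 1 := by ring
    rw [e, ← add_assoc]
    linear_combination (-cc (k + 1)) * this
  have hA := hX.add hTail
  rw [funext hk] at hA
  have hd : Summable fun n => cc 0 * (v n * v n) :=
    hS1.comp_injective (i := fun n : ℕ => (n, n)) (fun a b h => by simpa using h) |>.congr
      (fun n => by simp)
  have fin := ((hd.hasSum.add ((hA.sub hTail2).mul_left 2)).sub hT2)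
  rw [hsq, hT1]
  rw [add_sub_cancel_right] at fin
  refine fin.congr_fun fun k => ?_
  have : cc 0 = 2 := by simp [cc]
  rw [this]; ring


lemma lam_summable (a : ℕ → ℂ) (ha : ∀ n, ‖a n‖ ≤ n) {q : ℂ} (hq : ‖q‖ < 1) :
    Summable fun c : ℕ+ × ℕ+ => a c.2 * q ^ (c.1 * c.2 : ℕ) := by
  have h := (summable_prod_mul_pow 1 hq).norm
  refine Summable.of_norm_bounded h fun c => ?_
  rw [norm_mul, norm_mul]
  gcongr
  simpa using ha c.2

lemma lambert_aux (a : ℕ → ℂ) (ha : ∀ n, ‖a n‖ ≤ n) {q : ℂ} (hq : ‖q‖ < 1) :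
    HasSum (fun n : ℕ+ => (∑ d ∈ (n : ℕ).divisors, a d) * q ^ (n : ℕ))
      (∑' c : ℕ+ × ℕ+, a c.2 * q ^ (c.1 * c.2 : ℕ)) := by
  have h := sigmaAntidiagonalEquivProd.hasSum_iff.mpr (lam_summable a ha hq).hasSum
  refine h.sigma (fun n => ?_)
  have e : (∑ d ∈ (n : ℕ).divisors, a d) * q ^ (n : ℕ) =
      ∑ x ∈ (n : ℕ).divisorsAntidiagonal, a x.2 * q ^ (x.1 * x.2) := by
    rw [Nat.sum_divisorsAntidiagonal' (fun x y => a y * q ^ (x * y)), Finset.sum_mul]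
    refine Finset.sum_congr rfl fun d hd => ?_
    rw [Nat.div_mul_cancel (Nat.dvd_of_mem_divisors hd)]
  rw [e, ← Finset.sum_coe_sort]
  exact hasSum_fintype _

lemma pow_lt {q : ℂ} (hq : ‖q‖ < 1) (k : ℕ) : ‖q ^ (k + 1)‖ < 1 := by
  rw [norm_pow]; exact pow_lt_one₀ (norm_nonneg _) hq (by omega)

lemma one_sub_ne {q : ℂ} (hq : ‖q‖ < 1) (k : ℕ) : 1 - q ^ (k + 1) ≠ 0 := by
  intro h
  have := pow_lt hq k
  rw [← sub_eq_zero.mp h] at this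
  simp at this

def vv (q : ℂ) (k : ℕ) : ℂ := q ^ (k + 1) / (1 - q ^ (k + 1))

lemma vv_bound {q : ℂ} (hq : ‖q‖ < 1) (k : ℕ) : ‖vv q k‖ ≤ (1 / (1 - ‖q‖)) * ‖q‖ ^ k := by
  unfold vv
  rw [norm_div, norm_pow]
  have h1 : 1 - ‖q‖ ≤ ‖1 - q ^ (k + 1)‖ := by
    have := norm_sub_norm_le 1 (q ^ (k + 1))
    rw [norm_one, norm_pow] at this
    have h2 : ‖q‖ ^ (k + 1) ≤ ‖q‖ := pow_le_of_le_one (norm_nonneg _) hq.le (by omega)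
    linarith
  have h3 : ‖q‖ ^ (k + 1) ≤ ‖q‖ ^ k := pow_le_pow_of_le_one (norm_nonneg _) hq.le (by omega)
  rw [one_div_mul_eq_div]
  have : 0 < 1 - ‖q‖ := by linarith
  gcongr

lemma vv_id {q : ℂ} (hq : ‖q‖ < 1) (m n : ℕ) :
    vv q m * vv q n = vv q (m + n + 1) * (1 + vv q m + vv q n) := by
  unfold vv
  have h1 := one_sub_ne hq m
  have h2 := one_sub_ne hq n
  have h3 := one_sub_ne hq (m + n + 1)
  field_simp
  ring

lemma tsum_pnat_pow {x : ℂ} (hx : ‖x‖ < 1) : HasSum (fun n : ℕ+ => x ^ (n : ℕ)) (x / (1 - x)) := by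
  rw [← Equiv.pnatEquivNat.symm.hasSum_iff]
  have := (hasSum_geometric_of_norm_lt_one hx).mul_left x
  rw [div_eq_mul_inv]
  refine this.congr_fun fun n => ?_
  simp [pow_succ, mul_comm]

lemma lambert_hasSum (a : ℕ → ℂ) (ha : ∀ n, ‖a n‖ ≤ n) {q : ℂ} (hq : ‖q‖ < 1) :
    HasSum (fun k : ℕ => a (k + 1) * vv q k)
      (∑' c : ℕ+ × ℕ+, a c.2 * q ^ (c.1 * c.2 : ℕ)) := by
  have hs := lam_summable a ha hq
  have h := (Equiv.prodComm ℕ+ ℕ+).hasSum_iff.mpr hs.hasSum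
  have h2 : HasSum (fun n : ℕ+ => a n * (q ^ (n : ℕ) / (1 - q ^ (n : ℕ))))
      (∑' c : ℕ+ × ℕ+, a c.2 * q ^ (c.1 * c.2 : ℕ)) := by
    refine h.prod_fiberwise (fun n => ?_)
    have hn : ‖q ^ (n : ℕ)‖ < 1 := by
      rw [norm_pow]; exact pow_lt_one₀ (norm_nonneg _) hq n.ne_zero
    refine ((tsum_pnat_pow hn).mul_left (a n)).congr_fun fun m => ?_
    simp [← pow_mul, mul_comm]
  rw [← Equiv.pnatEquivNat.symm.hasSum_iff] at h2
  refine h2.congr_fun fun k => ?_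
  simp [vv]

lemma lambert_tsum (a : ℕ → ℂ) (ha : ∀ n, ‖a n‖ ≤ n) {q : ℂ} (hq : ‖q‖ < 1) :
    HasSum (fun k : ℕ => (∑ d ∈ (k + 1).divisors, a d) * q ^ (k + 1)) (∑' k, a (k + 1) * vv q k) := by
  rw [(lambert_hasSum a ha hq).tsum_eq]
  have h := lambert_aux a ha hq
  rw [← Equiv.pnatEquivNat.symm.hasSum_iff] at h
  refine h.congr_fun fun k => ?_
  simp

/-- the Lambert series for `σ₁` -/
def PP (q : ℂ) : ℂ := ∑' k : ℕ, ((k + 1 : ℕ) : ℂ) * vv q k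

lemma PP_hasSum {q : ℂ} (hq : ‖q‖ < 1) :
    HasSum (fun k : ℕ => ((k + 1 : ℕ) : ℂ) * vv q k) (PP q) :=
  (lambert_hasSum (fun n => (n : ℂ)) (fun n => by simp) hq).summable.hasSum

lemma PP_hasSum2 {q : ℂ} (hq : ‖q‖ < 1) :
    HasSum (fun k : ℕ => vv q k ^ 2 + vv q k) (PP q) := by
  have h1 := lambert_hasSum (fun n => (n : ℂ)) (fun n => by simp) hq
  rw [PP, h1.tsum_eq]
  have hs := lam_summable (fun n => (n : ℂ)) (fun n => by simp) hq
  have h2 : HasSum (fun n : ℕ+ => q ^ (n : ℕ) / (1 - q ^ (n : ℕ)) ^ 2)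
      (∑' c : ℕ+ × ℕ+, (c.2 : ℂ) * q ^ (c.1 * c.2 : ℕ)) := by
    refine hs.hasSum.prod_fiberwise (fun n => ?_)
    have hn : ‖q ^ (n : ℕ)‖ < 1 := by
      rw [norm_pow]; exact pow_lt_one₀ (norm_nonneg _) hq n.ne_zero
    have := hasSum_coe_mul_geometric_of_norm_lt_one hn
    rw [← hasSum_nat_add_iff' 1] at this
    simp only [Finset.range_one, Finset.sum_singleton, Nat.cast_zero, zero_mul, sub_zero] at this
    rw [← Equiv.pnatEquivNat.symm.hasSum_iff]
    refine this.congr_fun fun m => ?_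
    simp [← pow_mul]
  rw [← Equiv.pnatEquivNat.symm.hasSum_iff] at h2
  refine h2.congr_fun fun k => ?_
  have := one_sub_ne hq k
  simp only [vv, Function.comp, Equiv.pnatEquivNat_symm_apply, Nat.succPNat_coe, Nat.succ_eq_add_one]
  field_simp
  ring

theorem S_sq {q : ℂ} (hq : ‖q‖ < 1) :
    (1 + 6 * ∑' n, xx (n + 1) * vv q n) ^ 2 = 1 + 12 * PP q - 36 * PP (q ^ 3) := by
  have hq3 : ‖q ^ 3‖ < 1 := pow_lt hq 2
  have hc := core_id (norm_nonneg q) hq (vv_bound hq) (vv_id hq)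
  have hx : ∀ n, ‖xx n‖ ≤ n := by
    intro n
    rcases n with _ | n
    · simp [xx]
    · have : ‖xx (n + 1)‖ ≤ 1 := by unfold xx; split_ifs <;> simp
      push_cast
      linarith [(Nat.cast_nonneg n : (0:ℝ) ≤ n)]
  have hS := (lambert_hasSum xx hx hq).summable.hasSum
  set S := ∑' n, xx (n + 1) * vv q n with hSd
  have h3 : HasSum (fun k : ℕ => if (k + 1) % 3 = 0 then
      6 * vv q k ^ 2 + 6 * vv q k - 3 * ((k + 1 : ℕ) : ℂ) * vv q k else 0) (-3 * PP (q ^ 3)) := by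
    have inj : Function.Injective (fun m : ℕ => 3 * m + 2) := fun a b h => by
      simp only at h; omega
    rw [← inj.hasSum_iff]
    · have := ((PP_hasSum2 hq3).mul_left 6).sub ((PP_hasSum hq3).mul_left 9)
      have e : 6 * PP (q ^ 3) - 9 * PP (q ^ 3) = -3 * PP (q ^ 3) := by ring
      rw [e] at this
      refine this.congr_fun fun m => ?_
      have e1 : (3 * m + 2 + 1) % 3 = 0 := by omega
      have e2 : vv q (3 * m + 2) = vv (q ^ 3) m := by
        unfold vv
        rw [← pow_mul]
        ring_nf
      simp only [Function.comp, e1, if_true, e2]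
      push_cast
      ring
    · intro x hx
      rw [if_neg]
      intro h
      exact hx ⟨x / 3, by simp only; omega⟩
  have hL := hc.add hS
  have hR := (PP_hasSum hq).add h3
  have key : 3 * S ^ 2 + S = PP q + -3 * PP (q ^ 3) := by
    refine hL.unique (hR.congr_fun fun k => ?_)
    rw [CC_eq]
    unfold cc xx
    have h1 : k % 3 = 0 ∨ k % 3 = 1 ∨ k % 3 = 2 := by omega
    rcases h1 with h1 | h1 | h1
    · have a1 : (k + 1) % 3 = 1 := by omega
      simp only [h1, a1]; push_cast; norm_num; ring
    · have a1 : (k + 1) % 3 = 2 := by omega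
      simp only [h1, a1]; push_cast; norm_num; ring
    · have a1 : (k + 1) % 3 = 0 := by omega
      simp only [h1, a1]; push_cast; norm_num; ring
  linear_combination 12 * key


/-! ### Bridges to the concrete definitions -/

lemma uhp_open : IsOpen UHP := isOpen_lt continuous_const Complex.continuous_im

lemma qc_lt {τ : ℂ} (h : τ ∈ UHP) : ‖qc τ‖ < 1 := by
  have := UpperHalfPlane.norm_exp_two_pi_I_lt_one ⟨τ, h⟩
  exact this

lemma qc_tri (τ : ℂ) : qc (3 * τ) = qc τ ^ 3 := by
  unfold qc
  rw [← Complex.exp_nat_mul]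
  congr 1
  push_cast
  ring

lemma E2c_eq {τ : ℂ} (h : τ ∈ UHP) : _root_.E2 τ = 1 - 24 * PP (qc τ) := by
  unfold _root_.E2 sigmaC PP
  have := lambert_tsum (fun n => (n : ℂ)) (fun n => by simp) (qc_lt h)
  simp only [pow_one]
  rw [this.tsum_eq]

lemma E2_bridge (z : ℍ) : EisensteinSeries.E2 z = _root_.E2 (z : ℂ) := by
  rw [EisensteinSeries.E2_eq_tsum_cexp, _root_.E2,
    tsum_pnat_eq_tsum_succ (f := fun n ↦
      (ArithmeticFunction.sigma 1 n : ℂ) * cexp (2 * Real.pi * I * z) ^ n)]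
  congr 2
  refine tsum_congr fun n => ?_
  rw [sigmaC, ArithmeticFunction.sigma_apply]
  simp [qc]

lemma E4_bridge (z : ℍ) : ModularForm.E₄ z = _root_.E4 (z : ℂ) := by
  have h := E4_hasSum z
  have h2 := h.summable
  rw [← h.tsum_eq, h2.tsum_eq_zero_add, _root_.E4, ← tsum_mul_left]
  simp only [if_true, pow_zero, mul_one]
  congr 1
  refine tsum_congr fun n => ?_
  rw [sigmaC, ArithmeticFunction.sigma_apply]
  simp [qh, qc, mul_assoc]

lemma E13_eq {τ : ℂ} (h : τ ∈ UHP) : E1_3 τ = 1 + 6 * ∑' n, xx (n + 1) * vv (qc τ) n := by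
  have hx : ∀ n, ‖xx n‖ ≤ n := by
    intro n
    rcases n with _ | n
    · simp [xx]
    · have : ‖xx (n + 1)‖ ≤ 1 := by unfold xx; split_ifs <;> simp
      push_cast
      linarith [(Nat.cast_nonneg n : (0:ℝ) ≤ n)]
  rw [← (lambert_tsum xx hx (qc_lt h)).tsum_eq]
  rfl

lemma three_mem {τ : ℂ} (h : τ ∈ UHP) : 3 * τ ∈ UHP := by
  have : 0 < τ.im := h
  simpa [UHP] using this

lemma E13_sq {τ : ℂ} (h : τ ∈ UHP) :
    E1_3 τ ^ 2 = (3 * _root_.E2 (3 * τ) - _root_.E2 τ) / 2 := by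
  rw [E13_eq h, S_sq (qc_lt h), E2c_eq h, E2c_eq (three_mem h), qc_tri]
  ring

lemma A3_bridge (z : ℍ) : A3 z = E1_3 (z : ℂ) ^ 2 := by
  rw [E13_sq (τ := (z : ℂ)) z.im_pos, A3, E2_bridge, E2_bridge]
  rfl

lemma diff_of_md {X : ℍ → ℂ} (hX : MDiff X) {F : ℂ → ℂ} (h : ∀ z : ℍ, X z = F z) :
    DifferentiableOn ℂ F UHP := by
  rw [UpperHalfPlane.mdifferentiable_iff] at hX
  refine hX.congr fun τ hτ => ?_
  have := h ⟨τ, hτ⟩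
  rw [Function.comp, UpperHalfPlane.ofComplex_apply_of_im_pos hτ, this]

lemma E2_diff : DifferentiableOn ℂ _root_.E2 UHP := diff_of_md E2_mdifferentiable E2_bridge

lemma E4_diff : DifferentiableOn ℂ _root_.E4 UHP :=
  diff_of_md (ModularFormClass.holo ModularForm.E₄) E4_bridge

lemma qc_diff : Differentiable ℂ qc := by
  unfold qc; fun_prop

lemma E13_diff : DifferentiableOn ℂ E1_3 UHP := by
  intro τ hτ
  have hx : ∀ n, ‖xx n‖ ≤ n := by
    intro n
    rcases n with _ | n
    · simp [xx]
    · have : ‖xx (n + 1)‖ ≤ 1 := by unfold xx; split_ifs <;> simp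
      push_cast
      linarith [(Nat.cast_nonneg n : (0:ℝ) ≤ n)]
  obtain ⟨r, h1, h2⟩ := exists_between (qc_lt hτ)
  have hr0 : 0 ≤ r := (norm_nonneg _).trans h1.le
  have hs := (lambert_tsum xx hx (q := (r : ℂ)) (by simpa [abs_of_nonneg hr0] using h2)).summable.norm
  have hd : DifferentiableOn ℂ (fun q : ℂ => ∑' k : ℕ, (∑ d ∈ (k + 1).divisors, xx d) * q ^ (k + 1))
      (Metric.ball 0 r) := by
    refine differentiableOn_tsum_of_summable_norm hs (fun i => by fun_prop) Metric.isOpen_ball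
      (fun i w hw => ?_)
    have hw : ‖w‖ < r := by simpa using hw
    rw [norm_mul, norm_mul, norm_pow, norm_pow]
    gcongr
    simpa [abs_of_nonneg hr0] using hw.le
  have hd2 : DifferentiableAt ℂ
      (fun q : ℂ => ∑' k : ℕ, (∑ d ∈ (k + 1).divisors, xx d) * q ^ (k + 1)) (qc τ) :=
    hd.differentiableAt (Metric.isOpen_ball.mem_nhds (by simpa using h1))
  have hd3 := hd2.comp τ (qc_diff τ)
  exact ((hd3.const_mul 6).const_add 1).differentiableWithinAt

lemma eta_bridge : dedekindEta = ModularForm.eta := by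
  ext τ
  unfold dedekindEta ModularForm.eta
  simp only [ModularForm.eta_q_eq_pow]
  rw [Function.Periodic.qParam]
  rfl

lemma eta_ne {τ : ℂ} (h : τ ∈ UHP) : dedekindEta τ ≠ 0 := by
  rw [eta_bridge]; exact ModularForm.eta_ne_zero h

/-- the constant `2πi` -/
def cI : ℂ := 2 * (Real.pi : ℂ) * Complex.I

lemma cI_ne : cI ≠ 0 := by
  unfold cI
  simp [Real.pi_ne_zero]

lemma eta_deriv {τ : ℂ} (h : τ ∈ UHP) :
    HasDerivAt dedekindEta (cI * (_root_.E2 τ / 24 * dedekindEta τ)) τ := by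
  have hd : DifferentiableAt ℂ dedekindEta τ := by
    rw [eta_bridge]
    exact ModularForm.differentiableAt_eta_of_mem_upperHalfPlaneSet h
  have hl := ModularForm.logDeriv_eta_eq_E2 ⟨τ, h⟩
  rw [E2_bridge, ← eta_bridge, logDeriv_apply] at hl
  have hne := eta_ne h
  simp only at hl
  rw [div_eq_iff hne] at hl
  have := hd.hasDerivAt
  rw [hl] at this
  refine this.congr_deriv ?_
  unfold cI
  ring

lemma Dop_eq {f : ℂ → ℂ} {d τ : ℂ} (h : HasDerivAt f (cI * d) τ) : Dop f τ = d := by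
  rw [Dop, h.deriv]
  exact inv_mul_cancel_left₀ cI_ne d

lemma hasD {f : ℂ → ℂ} (hf : DifferentiableOn ℂ f UHP) {τ : ℂ} (h : τ ∈ UHP) :
    HasDerivAt f (cI * Dop f τ) τ := by
  have := (hf.differentiableAt (uhp_open.mem_nhds h)).hasDerivAt
  rw [Dop]
  have e : cI * ((2 * (Real.pi : ℂ) * Complex.I)⁻¹ * deriv f τ) = deriv f τ :=
    mul_inv_cancel_left₀ cI_ne _
  rwa [e]

lemma Dop_diff {f : ℂ → ℂ} (hf : DifferentiableOn ℂ f UHP) : DifferentiableOn ℂ (Dop f) UHP :=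
  (hf.deriv uhp_open).const_mul _

lemma Dop_congr {f g : ℂ → ℂ} (h : ∀ τ ∈ UHP, f τ = g τ) : ∀ τ ∈ UHP, Dop f τ = Dop g τ := by
  intro τ hτ
  have : f =ᶠ[𝓝 τ] g := Filter.eventuallyEq_of_mem (uhp_open.mem_nhds hτ) h
  rw [Dop, Dop, this.deriv_eq]

lemma D_bridge {X : ℍ → ℂ} {F : ℂ → ℂ} (h : ∀ z : ℍ, X z = F z) (z : ℍ) : D X z = Dop F z := by
  have : (X ∘ ofComplex) =ᶠ[𝓝 (z : ℂ)] F := by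
    refine Filter.eventuallyEq_of_mem (uhp_open.mem_nhds z.im_pos) fun τ hτ => ?_
    rw [Function.comp, UpperHalfPlane.ofComplex_apply_of_im_pos hτ, h]
  rw [normalizedDerivOfComplex, Dop, this.deriv_eq]

/-- the eta quotient -/
def gg (τ : ℂ) : ℂ := dedekindEta (3 * τ) ^ 6 / dedekindEta τ ^ 8

lemma gg_deriv {τ : ℂ} (h : τ ∈ UHP) :
    HasDerivAt gg (cI * (gg τ * (E1_3 τ ^ 2 / 2 - _root_.E2 τ / 12))) τ := by
  have h1 := eta_deriv h
  have h3 := (eta_deriv (three_mem h)).comp τ ((hasDerivAt_id τ).const_mul 3)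
  have hne := eta_ne h
  have hq := (h3.pow 6).div (h1.pow 8) (pow_ne_zero 8 hne)
  refine hq.congr_deriv ?_
  rw [E13_sq h]
  simp only [gg, Pi.pow_apply, Function.comp]
  field_simp
  ring

lemma ode_mul {τ : ℂ} (h : τ ∈ UHP) :
    gg τ ≠ 0 ∧ E1_3 τ ^ 3 * (Dop (Dop charG2) τ - (1 / 6 : ℂ) * _root_.E2 τ * Dop charG2 τ
          - (5 / 48 : ℂ) * _root_.E4 τ * charG2 τ) = 0 := by
  refine ⟨div_ne_zero (pow_ne_zero _ (eta_ne (three_mem h))) (pow_ne_zero _ (eta_ne h)), ?_⟩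
  set a := E1_3 with ha
  have da := E13_diff
  have da' := Dop_diff da
  have dE := E2_diff
  -- derivatives of `a ^ 2`
  have hA : ∀ t ∈ UHP, HasDerivAt (fun t => a t ^ 2) (cI * (2 * a t * Dop a t)) t := by
    intro t ht
    refine ((hasD da ht).pow 2).congr_deriv ?_
    simp
    ring
  have hA1 : ∀ t ∈ UHP, Dop (fun t => a t ^ 2) t = 2 * a t * Dop a t := fun t ht => Dop_eq (hA t ht)
  -- Serre derivatives
  have s1 : ∀ z : ℍ, serreDerivative 2 A3 z =
      (fun t : ℂ => 2 * a t * Dop a t - 1 / 6 * _root_.E2 t * a t ^ 2) z := by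
    intro z
    rw [serreDerivative_apply, D_bridge (F := fun t => a t ^ 2) A3_bridge, A3_bridge, E2_bridge, hA1 _ z.im_pos]
    ring
  have hF : HasDerivAt (fun t : ℂ => 2 * a t * Dop a t - 1 / 6 * _root_.E2 t * a t ^ 2)
      (cI * (2 * Dop a τ ^ 2 + 2 * a τ * Dop (Dop a) τ - 1 / 6 * (Dop _root_.E2 τ * a τ ^ 2
        + _root_.E2 τ * (2 * a τ * Dop a τ)))) τ := by
    refine ((((hasD da h).const_mul 2).mul (hasD da' h)).sub
      (((hasD dE h).const_mul (1 / 6)).mul (hA τ h))).congr_deriv ?_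
    ring
  have s2 := D_bridge (F := fun t : ℂ => 2 * a t * Dop a t - 1 / 6 * _root_.E2 t * a t ^ 2) s1 ⟨τ, h⟩
  have s3 := s1 ⟨τ, h⟩
  have hP := congrFun Phi_A3 ⟨τ, h⟩
  simp only at s2 s3
  rw [Dop_eq hF] at s2
  simp only [Phi, serreDerivative_apply 4, s2, s3, A3_bridge, E2_bridge, E4_bridge,
    Pi.zero_apply] at hP
  -- derivatives of the character
  have hf : charG2 = fun t => a t * gg t := by
    ext t
    rw [charG2, gg, mul_div_assoc]
  have d1 : ∀ t ∈ UHP, Dop charG2 t =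
      gg t * (Dop a t + a t * (a t ^ 2 / 2 - _root_.E2 t / 12)) := by
    intro t ht
    rw [hf]
    refine Dop_eq (((hasD da ht).mul (gg_deriv ht)).congr_deriv ?_)
    ring
  have hw : HasDerivAt (fun t => a t ^ 2 / 2 - _root_.E2 t / 12)
      (cI * (a τ * Dop a τ - Dop _root_.E2 τ / 12)) τ := by
    refine (((hA τ h).div_const 2).sub ((hasD dE h).div_const 12)).congr_deriv ?_
    ring
  have d2 : Dop (Dop charG2) τ = gg τ * ((a τ ^ 2 / 2 - _root_.E2 τ / 12) *
      (Dop a τ + a τ * (a τ ^ 2 / 2 - _root_.E2 τ / 12))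
      + (Dop (Dop a) τ + Dop a τ * (a τ ^ 2 / 2 - _root_.E2 τ / 12)
        + a τ * (a τ * Dop a τ - Dop _root_.E2 τ / 12))) := by
    rw [Dop_congr d1 τ h]
    refine Dop_eq (((gg_deriv h).mul ((hasD da' h).add ((hasD da h).mul hw))).congr_deriv ?_)
    simp only [Pi.add_apply, Pi.mul_apply]
    ring
  rw [d2, d1 τ h, hf]
  simp only at hP ⊢
  linear_combination gg τ * hP

lemma charG2_diff : DifferentiableOn ℂ charG2 UHP := by
  have hf : charG2 = fun t => E1_3 t * gg t := by
    ext t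
    rw [charG2, gg, mul_div_assoc]
  rw [hf]
  exact E13_diff.mul fun t ht => (gg_deriv ht).differentiableAt.differentiableWithinAt

lemma a_ne : ∃ τ ∈ UHP, E1_3 τ ≠ 0 := by
  by_contra! hc
  obtain ⟨-, g, -, hb, hg⟩ := jet_A3
  have h0 : ∀ z : ℍ, A3 z = 0 := fun z => by rw [A3_bridge, hc z z.im_pos]; simp
  -- `-1 = q * bounded`
  have hB : IsBoundedAtImInfty (fun z => 12 + 36 * qh z + qh z ^ 2 * g z) :=
    bdd_add (bdd_add (bdd_const _) (bdd_mul (bdd_const _) qh_bdd)) (bdd_mul (bdd_pow qh_bdd _) hb)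
  rw [UpperHalfPlane.isBoundedAtImInfty_iff] at hB
  obtain ⟨M, N, hM⟩ := hB
  have key : ∀ z : ℍ, N ≤ z.im → 1 ≤ Real.exp (-2 * Real.pi * z.im) * M := by
    intro z hz
    have e : (1 : ℂ) = -(qh z * (12 + 36 * qh z + qh z ^ 2 * g z)) := by
      have := hg z
      rw [h0] at this
      linear_combination -this
    have e2 := congrArg norm e
    rw [norm_one, norm_neg, norm_mul, norm_qh] at e2
    rw [e2]
    gcongr
    exact hM z hz
  have hlim : Filter.Tendsto (fun y : ℝ => Real.exp (-2 * Real.pi * y) * M) Filter.atTop (𝓝 (0 * M)) := by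
    refine Filter.Tendsto.mul_const M (Real.tendsto_exp_atBot.comp ?_)
    exact Filter.tendsto_id.const_mul_atTop_of_neg (by nlinarith [Real.pi_pos])
  rw [zero_mul] at hlim
  obtain ⟨y, hy1, hy2, hy3⟩ := ((hlim.eventually_lt_const (one_pos)).and
    ((Filter.eventually_ge_atTop N).and (Filter.eventually_gt_atTop 0))).exists
  have := key ⟨y * I, by simpa using hy3⟩ (by simpa [UpperHalfPlane.im] using hy2)
  have e : (⟨y * I, by simpa using hy3⟩ : ℍ).im = y := by simp [UpperHalfPlane.im]
  rw [e] at this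
  linarith

theorem main_ode : ∀ τ ∈ UHP, Dop (Dop charG2) τ - (1 / 6 : ℂ) * _root_.E2 τ * Dop charG2 τ
          - (5 / 48 : ℂ) * _root_.E4 τ * charG2 τ = 0 := by
  have hG : DifferentiableOn ℂ (fun τ => Dop (Dop charG2) τ - (1 / 6 : ℂ) * _root_.E2 τ * Dop charG2 τ
          - (5 / 48 : ℂ) * _root_.E4 τ * charG2 τ) UHP :=
    ((Dop_diff (Dop_diff charG2_diff)).sub ((E2_diff.const_mul _).mul (Dop_diff charG2_diff))).sub
      ((E4_diff.const_mul _).mul charG2_diff)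
  have hGa := hG.analyticOnNhd uhp_open
  obtain ⟨t, ht, hne⟩ := a_ne
  have hcont : ContinuousAt E1_3 t := (E13_diff.differentiableAt (uhp_open.mem_nhds ht)).continuousAt
  have hpc : IsPreconnected UHP := (convex_halfSpace_im_gt 0).isPreconnected
  refine hGa.eqOn_zero_of_preconnected_of_eventuallyEq_zero hpc ht ?_
  filter_upwards [hcont.eventually_ne hne, uhp_open.mem_nhds ht] with s hs hsU
  exact (mul_eq_zero.mp (ode_mul hsU).2).resolve_left (pow_ne_zero 3 hs)

end G2M

theorem charG2_holo_and_MLDE :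
    DifferentiableOn ℂ charG2 UHP ∧
      ∀ τ ∈ UHP,
        Dop (Dop charG2) τ - (1 / 6 : ℂ) * E2 τ * Dop charG2 τ
          - (5 / 48 : ℂ) * E4 τ * charG2 τ = 0 := by
  exact ⟨G2M.charG2_diff, G2M.main_ode⟩
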